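/- arXiv:1912.01082 — 3 statements merged into one kernel-verified Lean document; each statement's English description precedes it below -/
import Mathlib

section
/- For every integer m ≥ 1, writing K = 2m, the central binomial coefficient satisfies C(K, K/2) ≤ √(2/π) · e^{1/(12K)} · 2^K / √K. -/
/-- For every `m ≥ 1`, with `K = 2m`, the central binomial coefficient
satisfies `C(K, K/2) ≤ √(2/π) · e^{1/(12K)} · 2^K / √K`. -/
theorem central_binom_le_stirling_bound (m : ℕ) (hm : 1 ≤ m) :
    (((2 * m).choose m : ℕ) : ℝ) ≤
      Real.sqrt (2 / Real.pi) * Real.exp (1 / (12 * (2 * m))) * 2 ^ (2 * m) /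
        Real.sqrt (2 * m) := by
  have hπ := Real.pi_pos
  have hm0 : (0 : ℝ) < m := by exact_mod_cast hm
  have h1 := Real.Wallis.le_W m
  rw [Real.Wallis.W_eq_factorial_ratio] at h1
  have hf : ((2 * m).choose m : ℝ) * (m.factorial : ℝ) ^ 2 = ((2 * m).factorial : ℝ) := by
    have := Nat.choose_mul_factorial_mul_factorial (show m ≤ 2 * m by omega)
    rw [show 2 * m - m = m by omega] at this
    rw [← this]; push_cast; ring
  have hfp : (0 : ℝ) < m.factorial := by exact_mod_cast m.factorial_pos
  have hcp : (0 : ℝ) < ((2 * m).choose m : ℝ) := by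
    exact_mod_cast Nat.choose_pos (show m ≤ 2 * m by omega)
  rw [← hf] at h1
  generalize ((2 * m).choose m : ℝ) = c at *
  generalize (m.factorial : ℝ) = f at *
  have h2 : (2 : ℝ) ^ (4 * m) * f ^ 4 / ((c * f ^ 2) ^ 2 * (2 * m + 1))
      = (2 : ℝ) ^ (4 * m) / (c ^ 2 * (2 * m + 1)) := by
    field_simp
  rw [h2] at h1
  rw [le_div_iff₀ (by positivity)] at h1
  have h3 : c ^ 2 * (Real.pi * m) ≤ (2 : ℝ) ^ (4 * m) := by
    refine le_trans ?_ h1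
    have : (m : ℝ) ≤ (2 * m + 1) / (2 * m + 2) * (1 / 2) * (2 * m + 1) := by
      rw [div_mul_eq_mul_div, div_mul_eq_mul_div, le_div_iff₀ (by positivity)]
      nlinarith
    have := mul_le_mul_of_nonneg_left this (show 0 ≤ c ^ 2 * Real.pi by positivity)
    linarith
  have hE : 1 ≤ Real.exp (1 / (12 * (2 * (m : ℝ)))) := Real.one_le_exp (by positivity)
  have h4 : c ≤ Real.sqrt (2 / Real.pi) * 2 ^ (2 * m) / Real.sqrt (2 * m) := by
    refine (sq_le_sq₀ hcp.le (by positivity)).1 ?_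
    rw [div_pow, mul_pow, Real.sq_sqrt (by positivity), Real.sq_sqrt (by positivity), ← pow_mul,
      show 2 * m * 2 = 4 * m by ring, le_div_iff₀ (by positivity), div_mul_eq_mul_div,
      le_div_iff₀ hπ]
    linarith
  refine h4.trans ?_
  gcongr
  exact le_mul_of_one_le_right (by positivity) hE
end

section
/- Every optimal placement a for problem P1 uses the cache memory fully, i.e., the cache size constraint holds with equality: ∑_{n=1}^N ∑_{l=1}^K C(K−1,l−1)·a_{n,l} = M. -/
open Finset

/-- The average delivery rate `R̄(a)` of the coded caching scheme for `K` users,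
`N` files with popularities `p 1 ≥ … ≥ p N`, under cache placement `a`:
`R̄(a) = ∑_{d ∈ {1,…,N}^K} (∏_k p_{d k}) · ∑_{∅ ≠ S ⊆ {1,…,K}} max_{k ∈ S} a_{d k, |S|−1}`. -/
noncomputable def avgRate (K N : ℕ) (p : ℕ → ℝ) (a : ℕ → ℕ → ℝ) : ℝ :=
  ∑ d ∈ Fintype.piFinset (fun _ : Fin K => Finset.Icc 1 N),
    (∏ k, p (d k)) *
      ∑ S : Finset (Fin K),
        if h : S.Nonempty then S.sup' h (fun k => a (d k) (S.card - 1)) else 0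

/-- Feasibility for problem P1: file partition, cache size bound,
nonnegativity, and the popularity-first property. -/
def FeasibleP1 (K N : ℕ) (M : ℝ) (a : ℕ → ℕ → ℝ) : Prop :=
  (∀ n ∈ Finset.Icc 1 N,
      ∑ l ∈ Finset.range (K + 1), (K.choose l : ℝ) * a n l = 1) ∧
  (∑ n ∈ Finset.Icc 1 N, ∑ l ∈ Finset.Icc 1 K,
      ((K - 1).choose (l - 1) : ℝ) * a n l ≤ M) ∧
  (∀ n ∈ Finset.Icc 1 N, ∀ l ∈ Finset.range (K + 1), 0 ≤ a n l) ∧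
  (∀ n ∈ Finset.Icc 1 (N - 1), ∀ l ∈ Finset.Icc 1 K, a (n + 1) l ≤ a n l)

/-- Optimality for problem P1: feasibility together with minimality of the
average delivery rate among all feasible placements. -/
noncomputable def OptimalP1 (K N : ℕ) (M : ℝ) (p : ℕ → ℝ) (a : ℕ → ℕ → ℝ) : Prop :=
  FeasibleP1 K N M a ∧
    ∀ b : ℕ → ℕ → ℝ, FeasibleP1 K N M b → avgRate K N p a ≤ avgRate K N p b

/-- Every optimal placement for P1 uses the cache memory fully: the cache-size
constraint holds with equality. -/
theorem optimal_placement_full_cache_use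
    (K N : ℕ) (hK : 1 ≤ K) (hN : 1 ≤ N) (p : ℕ → ℝ) (M : ℝ)
    (hp_pos : ∀ n ∈ Finset.Icc 1 N, 0 < p n)
    (hp_mono : ∀ n ∈ Finset.Icc 1 (N - 1), p (n + 1) ≤ p n)
    (hp_sum : ∑ n ∈ Finset.Icc 1 N, p n = 1)
    (hM0 : 0 ≤ M) (hMN : M ≤ (N : ℝ))
    (a : ℕ → ℕ → ℝ) (hopt : OptimalP1 K N M p a) :
    ∑ n ∈ Finset.Icc 1 N, ∑ l ∈ Finset.Icc 1 K,
      ((K - 1).choose (l - 1) : ℝ) * a n l = M := by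
  classical
  obtain ⟨⟨hpart, hcache, hnn, hpop⟩, hmin⟩ := hopt
  by_contra hne
  set c : ℝ := ∑ n ∈ Finset.Icc 1 N, ∑ l ∈ Finset.Icc 1 K,
      ((K - 1).choose (l - 1) : ℝ) * a n l with hc
  have hlt : c < M := lt_of_le_of_ne hcache hne
  have hcN : 0 < (N : ℝ) - c := by linarith
  set t : ℝ := (M - c) / ((N : ℝ) - c) with ht
  have ht0 : 0 < t := div_pos (by linarith) hcN
  have ht1 : t ≤ 1 := (div_le_one hcN).2 (by linarith)
  have htc : t * ((N : ℝ) - c) = M - c := div_mul_cancel₀ _ hcN.ne'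
  let e : ℕ → ℝ := fun l => if l = K then 1 else 0
  let b : ℕ → ℕ → ℝ := fun n l => (1 - t) * a n l + t * e l
  have he1 : ∑ l ∈ Finset.range (K + 1), (K.choose l : ℝ) * e l = 1 := by
    simp [e]
  have he2 : ∑ l ∈ Finset.Icc 1 K, ((K - 1).choose (l - 1) : ℝ) * e l = 1 := by
    simp [e, hK]
  have hb : FeasibleP1 K N M b := by
    refine ⟨?_, ?_, ?_, ?_⟩
    · intro n hn
      have : ∀ l, (K.choose l : ℝ) * b n l =
          (1 - t) * ((K.choose l : ℝ) * a n l) + t * ((K.choose l : ℝ) * e l) := by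
        intro l; simp only [b]; ring
      simp only [this, Finset.sum_add_distrib, ← Finset.mul_sum, hpart n hn, he1]
      ring
    · have : ∀ n l, ((K - 1).choose (l - 1) : ℝ) * b n l =
          (1 - t) * (((K - 1).choose (l - 1) : ℝ) * a n l)
            + t * (((K - 1).choose (l - 1) : ℝ) * e l) := by
        intro n l; simp only [b]; ring
      simp only [this, Finset.sum_add_distrib, ← Finset.mul_sum, he2]
      rw [← hc]
      simp only [Finset.sum_const, Nat.card_Icc, nsmul_eq_mul]
      simp only [Nat.add_sub_cancel]
      nlinarith
    · intro n hn l hl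
      have h1 := hnn n hn l hl
      have h2 : 0 ≤ e l := by simp only [e]; split_ifs <;> norm_num
      have h3 : 0 ≤ 1 - t := by linarith
      simp only [b]
      positivity
    · intro n hn l hl
      have h1 := hpop n hn l hl
      have h3 : 0 ≤ 1 - t := by linarith
      have := mul_le_mul_of_nonneg_left h1 h3
      simp only [b]
      linarith
  have hcard : ∀ S : Finset (Fin K), S.Nonempty → S.card - 1 < K := by
    intro S hS
    have h1 := Finset.card_le_univ S
    have h2 := hS.card_pos
    simp only [Fintype.card_fin] at h1
    omega
  have hle := hmin b hb
  have hterm : ∀ d ∈ Fintype.piFinset (fun _ : Fin K => Finset.Icc 1 N),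
      ∀ S : Finset (Fin K), 0 ≤ (if h : S.Nonempty then
        S.sup' h (fun k => a (d k) (S.card - 1)) else 0) := by
    intro d hd S
    split_ifs with h
    · obtain ⟨k, hk⟩ := id h
      refine le_trans (hnn (d k) (Fintype.mem_piFinset.1 hd k) (S.card - 1) ?_)
        (Finset.le_sup' (fun k => a (d k) (S.card - 1)) hk)
      have := hcard S h
      simp only [Finset.mem_range]; omega
    · exact le_rfl
  have hprod : ∀ d ∈ Fintype.piFinset (fun _ : Fin K => Finset.Icc 1 N),
      0 < ∏ k, p (d k) := fun d hd =>
    Finset.prod_pos fun k _ => hp_pos _ (Fintype.mem_piFinset.1 hd k)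
  have hRb : avgRate K N p b ≤ (1 - t) * avgRate K N p a := by
    unfold avgRate
    rw [Finset.mul_sum]
    refine Finset.sum_le_sum fun d hd => ?_
    rw [mul_left_comm]
    refine mul_le_mul_of_nonneg_left ?_ (hprod d hd).le
    rw [Finset.mul_sum]
    refine Finset.sum_le_sum fun S _ => ?_
    split_ifs with h
    · refine Finset.sup'_le h _ fun k hk => ?_
      have h0 : e (S.card - 1) = 0 := if_neg (hcard S h).ne
      simp only [b, h0, mul_zero, add_zero]
      exact mul_le_mul_of_nonneg_left
        (Finset.le_sup' (fun k => a (d k) (S.card - 1)) hk) (by linarith)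
    · simp
  have hR0 : avgRate K N p a ≤ 0 := by nlinarith
  have hnnterm : ∀ d ∈ Fintype.piFinset (fun _ : Fin K => Finset.Icc 1 N),
      0 ≤ (∏ k, p (d k)) * ∑ S : Finset (Fin K), (if h : S.Nonempty then
        S.sup' h (fun k => a (d k) (S.card - 1)) else 0) := fun d hd =>
    mul_nonneg (hprod d hd).le (Finset.sum_nonneg fun S _ => hterm d hd S)
  have hR : avgRate K N p a = 0 := le_antisymm hR0 (Finset.sum_nonneg hnnterm)
  have hz : ∀ n ∈ Finset.Icc 1 N, ∀ l < K, a n l = 0 := by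
    intro n hn l hl
    have hd : (fun _ : Fin K => n) ∈ Fintype.piFinset (fun _ : Fin K => Finset.Icc 1 N) :=
      Fintype.mem_piFinset.2 fun _ => hn
    have h1 := (Finset.sum_eq_zero_iff_of_nonneg hnnterm).1 hR _ hd
    have h2 := (mul_eq_zero.1 h1).resolve_left (hprod _ hd).ne'
    obtain ⟨S, -, hS⟩ := Finset.exists_subset_card_eq
      (s := (Finset.univ : Finset (Fin K))) (n := l + 1) (by simpa using hl)
    have h3 := (Finset.sum_eq_zero_iff_of_nonneg
      (fun S _ => hterm _ hd S)).1 h2 S (Finset.mem_univ S)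
    have hne : S.Nonempty := Finset.card_pos.1 (by omega)
    rw [dif_pos hne, Finset.sup'_const, hS] at h3
    simpa using h3
  have hone : ∀ n ∈ Finset.Icc 1 N, a n K = 1 := by
    intro n hn
    have h := hpart n hn
    rw [Finset.sum_range_succ, Finset.sum_eq_zero] at h
    · simpa using h
    · intro l hl
      rw [hz n hn l (Finset.mem_range.1 hl), mul_zero]
  have hcN' : c = N := by
    have : ∀ n ∈ Finset.Icc 1 N, ∑ l ∈ Finset.Icc 1 K,
        ((K - 1).choose (l - 1) : ℝ) * a n l = 1 := by
      intro n hn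
      rw [← he2]
      refine Finset.sum_congr rfl fun l hl => ?_
      by_cases h : l = K
      · subst h; simp [e, hone n hn]
      · have : l < K := lt_of_le_of_ne (Finset.mem_Icc.1 hl).2 h
        simp [e, h, hz n hn l this]
    rw [hc, Finset.sum_congr rfl this]
    simp
  linarith
end

section
/- (Closed-form two-file-group placement, Case 2.ii.) Let K ≥ 1, N ≥ 2 be integers, M > 0 a real, n_o an integer with 1 ≤ n_o ≤ N−1, and l_o, l_1 integers with 1 ≤ l_o, l_1 ≤ K, l_o ≠ l_1, and l_1·n_o ≠ l_o·N. Suppose real numbers x, w, z satisfy the three equations C(K,l_o)·x + C(K,l_1)·w = 1 (file partition for the first group), z + C(K,l_o)·x = 1 (file partition for the second group), and N·C(K−1,l_o−1)·x + n_o·C(K−1,l_1−1)·w = M (full cache use). Then necessarily x = (1/C(K,l_o)) · (KM − l_1 n_o)/(l_o N − l_1 n_o), w = (1/C(K,l_1)) · (l_o N − KM)/(l_o N − l_1 n_o), and z = (l_o N − KM)/(l_o N − l_1 n_o). Moreover, x, w, z are all strictly positive if and only if either (C1) l_o > KM/N and l_1 < KM/n_o, or (C2) l_o < KM/N and l_1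 > KM/n_o. -/
theorem choose_aux (K l : ℕ) (hK : 1 ≤ K) (hl : 1 ≤ l) :
    (K : ℝ) * ((K - 1).choose (l - 1) : ℝ) = (l : ℝ) * (K.choose l : ℝ) := by
  obtain ⟨k, rfl⟩ := Nat.exists_eq_add_of_le' hK
  obtain ⟨m, rfl⟩ := Nat.exists_eq_add_of_le' hl
  have h := Nat.add_one_mul_choose_eq k m
  simp only [Nat.add_sub_cancel]
  rw [mul_comm ((m + 1 : ℕ) : ℝ)]
  exact_mod_cast h

/-- Closed-form two-file-group placement, Case 2.ii. If `x = a_{n_o,l_o}`,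
`w = a_{n_o,l_1}`, `z = a_{n_o+1,0}` satisfy the two file-partition equations
and the full-cache-use equation, then they are given by the stated closed
forms, and `x, w, z > 0` holds iff either condition (C1) or (C2) holds. -/
theorem two_group_closed_form_case_ii
    (K N n_o l_o l_1 : ℕ) (M x w z : ℝ)
    (hK : 1 ≤ K) (hN : 2 ≤ N) (hM : 0 < M)
    (hno1 : 1 ≤ n_o) (hno2 : n_o ≤ N - 1)
    (hlo1 : 1 ≤ l_o) (hlo2 : l_o ≤ K) (hl11 : 1 ≤ l_1) (hl12 : l_1 ≤ K)
    (hne : l_o ≠ l_1) (hnd : l_1 * n_o ≠ l_o * N)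
    (h1 : (K.choose l_o : ℝ) * x + (K.choose l_1 : ℝ) * w = 1)
    (h2 : z + (K.choose l_o : ℝ) * x = 1)
    (h3 : (N : ℝ) * ((K - 1).choose (l_o - 1) : ℝ) * x
        + (n_o : ℝ) * ((K - 1).choose (l_1 - 1) : ℝ) * w = M) :
    (x = (1 / (K.choose l_o : ℝ)) *
        (((K : ℝ) * M - (l_1 : ℝ) * (n_o : ℝ)) /
          ((l_o : ℝ) * (N : ℝ) - (l_1 : ℝ) * (n_o : ℝ))) ∧
      w = (1 / (K.choose l_1 : ℝ)) *
        (((l_o : ℝ) * (N : ℝ) - (K : ℝ) * M) /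
          ((l_o : ℝ) * (N : ℝ) - (l_1 : ℝ) * (n_o : ℝ))) ∧
      z = ((l_o : ℝ) * (N : ℝ) - (K : ℝ) * M) /
          ((l_o : ℝ) * (N : ℝ) - (l_1 : ℝ) * (n_o : ℝ))) ∧
    ((0 < x ∧ 0 < w ∧ 0 < z) ↔
      (((K : ℝ) * M / (N : ℝ) < (l_o : ℝ) ∧
          (l_1 : ℝ) < (K : ℝ) * M / (n_o : ℝ)) ∨
        ((l_o : ℝ) < (K : ℝ) * M / (N : ℝ) ∧
          (K : ℝ) * M / (n_o : ℝ) < (l_1 : ℝ)))) := by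
  have e0 := choose_aux K l_o hK hlo1
  have e1 := choose_aux K l_1 hK hl11
  have c0 : (0 : ℝ) < (K.choose l_o : ℝ) := by exact_mod_cast Nat.choose_pos hlo2
  have c1 : (0 : ℝ) < (K.choose l_1 : ℝ) := by exact_mod_cast Nat.choose_pos hl12
  have hNp : (0 : ℝ) < (N : ℝ) := by exact_mod_cast (by omega : 0 < N)
  have hnp : (0 : ℝ) < (n_o : ℝ) := by exact_mod_cast (by omega : 0 < n_o)
  have hD : (l_o : ℝ) * (N : ℝ) - (l_1 : ℝ) * (n_o : ℝ) ≠ 0 := by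
    intro h
    apply hnd
    have h' : (l_1 : ℝ) * (n_o : ℝ) = (l_o : ℝ) * (N : ℝ) := by linarith
    exact_mod_cast h'
  generalize (K.choose l_o : ℝ) = c at *
  generalize (K.choose l_1 : ℝ) = d at *
  have h4 : (l_o : ℝ) * N * (c * x) + (l_1 : ℝ) * n_o * (d * w) = K * M := by
    rw [← h3]
    linear_combination (-(N : ℝ) * x) * e0 - (n_o : ℝ) * w * e1
  have hA : ((l_o : ℝ) * N - l_1 * n_o) * (c * x) = K * M - l_1 * n_o := by
    linear_combination h4 - (l_1 : ℝ) * n_o * h1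
  have hB : ((l_o : ℝ) * N - l_1 * n_o) * (d * w) = l_o * N - K * M := by
    linear_combination (l_o : ℝ) * N * h1 - h4
  have hz : z = d * w := by linarith
  refine ⟨⟨?_, ?_, ?_⟩, ?_⟩
  · rw [← hA]; field_simp
  · rw [← hB]; field_simp
  · rw [← hB, hz]; field_simp
  · rw [div_lt_iff₀ hNp, lt_div_iff₀ hnp, lt_div_iff₀ hNp, div_lt_iff₀ hnp]
    constructor
    · rintro ⟨hx, hw, -⟩
      have hcx := mul_pos c0 hx
      have hdw := mul_pos c1 hw
      rcases lt_or_gt_of_ne hD with h | h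
      · right
        have a := mul_neg_of_neg_of_pos h hcx
        have b := mul_neg_of_neg_of_pos h hdw
        constructor <;> linarith
      · left
        have a := mul_pos h hcx
        have b := mul_pos h hdw
        constructor <;> linarith
    · intro h
      have key : 0 < c * x ∧ 0 < d * w := by
        rcases h with ⟨p, q⟩ | ⟨p, q⟩
        · have hp : 0 < (l_o : ℝ) * N - l_1 * n_o := by linarith
          exact ⟨(mul_pos_iff_of_pos_left hp).1 (by linarith),
            (mul_pos_iff_of_pos_left hp).1 (by linarith)⟩
        · have hp : (l_o : ℝ) * N - l_1 * n_o < 0 := by linarith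
          constructor
          · by_contra hc
            have := mul_nonneg_of_nonpos_of_nonpos hp.le (not_lt.1 hc)
            linarith
          · by_contra hc
            have := mul_nonneg_of_nonpos_of_nonpos hp.le (not_lt.1 hc)
            linarith
      exact ⟨(mul_pos_iff_of_pos_left c0).1 key.1, (mul_pos_iff_of_pos_left c1).1 key.2,
        hz ▸ key.2⟩
end
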